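/- arXiv:math/0111026 — 5 statements merged into one kernel-verified Lean document; each statement's English description precedes it below -/
import Mathlib

section
/- For all a, c ∈ A one has conj(φ(S(c)* a)) = φ(c S(a)* δ); equivalently, the involution of the functional â is given by (â)* = (S(a)* δ)^. (Lemma 2.1(1).) -/
open scoped TensorProduct ComplexOrder

noncomputable section

/-- Right slice map `(id ⊗ φ) : M ⊗ A → M`. -/
def rslice {A M : Type*} [AddCommGroup A] [Module ℂ A] [AddCommGroup M] [Module ℂ M]
    (φ : A →ₗ[ℂ] ℂ) : M ⊗[ℂ] A →ₗ[ℂ] M :=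
  (TensorProduct.rid ℂ M).toLinearMap ∘ₗ TensorProduct.map LinearMap.id φ

/-- Left slice map `(φ ⊗ id) : A ⊗ M → M`. -/
def lslice {A M : Type*} [AddCommGroup A] [Module ℂ A] [AddCommGroup M] [Module ℂ M]
    (φ : A →ₗ[ℂ] ℂ) : A ⊗[ℂ] M →ₗ[ℂ] M :=
  (TensorProduct.lid ℂ M).toLinearMap ∘ₗ TensorProduct.map φ LinearMap.id

/-- The pairing `(ω ⊗ η) : A ⊗ A → ℂ`. -/
def pair {A : Type*} [AddCommGroup A] [Module ℂ A] (ω η : A →ₗ[ℂ] ℂ) :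
    A ⊗[ℂ] A →ₗ[ℂ] ℂ :=
  LinearMap.mul' ℂ ℂ ∘ₗ TensorProduct.map ω η

/-- Convolution product of linear functionals: `ω₁·ω₂ = (ω₁ ⊗ ω₂) ∘ Δ`. -/
def conv {A : Type*} [Ring A] [Algebra ℂ A] (Δ : A →ₐ[ℂ] A ⊗[ℂ] A)
    (ω η : A →ₗ[ℂ] ℂ) : A →ₗ[ℂ] ℂ :=
  pair ω η ∘ₗ Δ.toLinearMap

/-- The conjugate dual functional `x ↦ conj (ω (x*))`. -/
def conjdual {A : Type*} [Ring A] [Algebra ℂ A] [StarRing A] [StarModule ℂ A]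
    (ω : A →ₗ[ℂ] ℂ) : A →ₗ[ℂ] ℂ where
  toFun x := starRingEnd ℂ (ω (star x))
  map_add' x y := by simp
  map_smul' c x := by simp [star_smul, smul_eq_mul, map_mul]

/-- A (unital) algebraic quantum group: a unital Hopf ∗-algebra over ℂ with a
positive faithful left Haar integral, together with the associated modular
data `ρ`, `δ`, `μ`. -/
structure AQG (A : Type*) [Ring A] [Algebra ℂ A] [StarRing A] [StarModule ℂ A] where
  Δ : A →ₐ[ℂ] A ⊗[ℂ] A
  ε : A →ₐ[ℂ] ℂ
  S : A →ₗ[ℂ] A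
  Sinv : A →ₗ[ℂ] A
  φ : A →ₗ[ℂ] ℂ
  ρ : A →ₗ[ℂ] A
  ρinv : A →ₗ[ℂ] A
  δ : A
  δinv : A
  μ : ℂ
  /-- `Δ` is a ∗-homomorphism (expressed by composing with functionals, since
  they separate points of `A ⊗ A`). -/
  Δ_star : ∀ (f g : A →ₗ[ℂ] ℂ) (a : A),
    pair f g (Δ (star a)) = starRingEnd ℂ (pair (conjdual f) (conjdual g) (Δ a))
  ε_star : ∀ a, ε (star a) = starRingEnd ℂ (ε a)
  coassoc : ∀ a, TensorProduct.assoc ℂ A A A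
      (TensorProduct.map Δ.toLinearMap LinearMap.id (Δ a)) =
      TensorProduct.map LinearMap.id Δ.toLinearMap (Δ a)
  counit_left : ∀ a, lslice ε.toLinearMap (Δ a) = a
  counit_right : ∀ a, rslice ε.toLinearMap (Δ a) = a
  S_leftinv : Function.LeftInverse Sinv S
  S_rightinv : Function.RightInverse Sinv S
  S_antimul : ∀ a b, S (a * b) = S b * S a
  S_one : S 1 = 1
  antipode_left : ∀ a, LinearMap.mul' ℂ A (TensorProduct.map S LinearMap.id (Δ a)) = ε a • 1
  antipode_right : ∀ a, LinearMap.mul' ℂ A (TensorProduct.map LinearMap.id S (Δ a)) = ε a • 1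
  S_star_S : ∀ a, S (star (S (star a))) = a
  /-- positivity of the Haar functional -/
  φ_pos : ∀ a, 0 ≤ φ (star a * a)
  φ_faithful : ∀ a, φ (star a * a) = 0 → a = 0
  /-- left invariance: `(id ⊗ φ)(Δ a) = φ(a)·1` -/
  φ_left_inv : ∀ a, rslice φ (Δ a) = φ a • (1 : A)
  /-- strong left invariance -/
  φ_strong : ∀ a b, rslice φ ((1 ⊗ₜ[ℂ] a) * Δ b) = S (rslice φ (Δ a * (1 ⊗ₜ[ℂ] b)))
  ρ_mul : ∀ a b, ρ (a * b) = ρ a * ρ b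
  ρ_leftinv : Function.LeftInverse ρinv ρ
  ρ_rightinv : Function.RightInverse ρinv ρ
  φ_ρ : ∀ a b, φ (a * b) = φ (b * ρ a)
  δ_star : star δ = δ
  δ_mul_δinv : δ * δinv = 1
  δinv_mul_δ : δinv * δ = 1
  Δ_δ : Δ δ = δ ⊗ₜ[ℂ] δ
  ε_δ : ε δ = 1
  S_δ : S δ = δinv
  μ_norm : ‖μ‖ = 1
  φ_S : ∀ a, φ (S a) = φ (a * δ)
  φ_δ : ∀ a, φ (a * δ) = μ * φ (δ * a)

namespace AQG

variable {A : Type*} [Ring A] [Algebra ℂ A] [StarRing A] [StarModule ℂ A] (G : AQG A)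

/-- `â : c ↦ φ(c a)`. -/
def hat (a : A) : A →ₗ[ℂ] ℂ := G.φ ∘ₗ LinearMap.mulRight ℂ a

/-- Involution on functionals: `ω*(x) = conj (ω (S(x)*))`. -/
def inv' (ω : A →ₗ[ℂ] ℂ) : A →ₗ[ℂ] ℂ := conjdual ω ∘ₗ G.S

end AQG


/-- A positive functional on a unital ∗-algebra is hermitian. -/
theorem map_star_of_nonneg {A : Type*} [Ring A] [Algebra ℂ A] [StarRing A] [StarModule ℂ A]
    (φ : A →ₗ[ℂ] ℂ) (hφ : ∀ a, 0 ≤ φ (star a * a)) (x : A) :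
    φ (star x) = starRingEnd ℂ (φ x) := by
  have him : ∀ a, (φ (star a * a)).im = 0 := fun a => (Complex.nonneg_iff.1 (hφ a)).2.symm
  have hx := him x
  have h1 := him 1
  have hadd := him (x + 1)
  have hadd' := him (x + Complex.I • 1)
  simp only [star_add, star_smul, star_one, add_mul, mul_add, mul_one, one_mul, map_add,
    mul_smul_comm, smul_mul_assoc, map_smul, smul_eq_mul, Complex.add_im, Complex.mul_im,
    Complex.mul_re, Complex.star_def, Complex.conj_I, Complex.I_re, Complex.I_im, Complex.neg_re,
    Complex.neg_im] at hx h1 hadd hadd'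
  apply Complex.ext <;> simp only [Complex.conj_re, Complex.conj_im] <;> linarith

/-- Lemma 2.1(1): `conj (φ(S(c)* a)) = φ(c S(a)* δ)`, i.e. `(â)* = (S(a)* δ)^`. -/
theorem stmt0 {A : Type*} [Ring A] [Algebra ℂ A] [StarRing A] [StarModule ℂ A]
    (G : AQG A) :
    ∀ a c : A,
      starRingEnd ℂ (G.φ (star (G.S c) * a)) = G.φ (c * (star (G.S a) * G.δ)) := by
  intro a c
  have hS : G.S (star (G.S a)) = star a := by simpa using G.S_star_S (star a)
  rw [← map_star_of_nonneg G.φ G.φ_pos, star_mul, star_star, ← hS, ← G.S_antimul, G.φ_S,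
    mul_assoc]
end
end

section
/- For all a, b, e, f ∈ A such that ê = â · b̂ and f̂ = b̂ · (S²(a) δ⁻¹)^ (convolution products of linear functionals on A), one has ε(e) = ε(f). Equivalently ψ̂(â · b̂) = ψ̂(b̂ · (S²(a) δ⁻¹)^) for all a, b ∈ A, which expresses the identity ρ̂(â) = (S²(a) δ⁻¹)^ for the modular automorphism ρ̂ of the dual determined by ψ̂(ω η) = ψ̂(η ρ̂(ω)). (Lemma 2.2(1).) -/
open scoped TensorProduct ComplexOrder

noncomputable section

namespace AQG

variable {A : Type*} [Ring A] [Algebra ℂ A] [StarRing A] [StarModule ℂ A] (G : AQG A)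

theorem pair_hat_hat (a b : A) (t : A ⊗[ℂ] A) :
    pair (G.hat a) (G.hat b) t = G.φ (rslice G.φ (t * (1 ⊗ₜ[ℂ] b)) * a) := by
  induction t with
  | zero => simp
  | add x y hx hy => simp only [map_add, add_mul, hx, hy]
  | tmul x y => simp [pair, hat, rslice, mul_comm]

theorem apply_rslice_one_tmul_mul (ψ : A →ₗ[ℂ] ℂ) (c : A) (t : A ⊗[ℂ] A) :
    ψ (rslice G.φ ((1 ⊗ₜ[ℂ] c) * t)) = G.φ (c * lslice ψ t) := by
  induction t with
  | zero => simp
  | add x y hx hy => simp only [map_add, mul_add, hx, hy]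
  | tmul x y => simp [rslice, lslice, mul_comm]

theorem ε_lslice (ψ : A →ₗ[ℂ] ℂ) (t : A ⊗[ℂ] A) :
    G.ε (lslice ψ t) = ψ (rslice G.ε.toLinearMap t) := by
  induction t with
  | zero => simp
  | add x y hx hy => simp only [map_add, hx, hy]
  | tmul x y => simp [rslice, lslice, mul_comm]

theorem hat_injective : Function.Injective G.hat := by
  intro a b h
  rw [← sub_eq_zero]
  apply G.φ_faithful
  have key := LinearMap.congr_fun h (star (a - b))
  simp only [hat, LinearMap.comp_apply, LinearMap.mulRight_apply] at key
  rw [mul_sub, map_sub, key, sub_self]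

/-- The convolution product `â · b̂` is the functional represented by
`(φ(S⁻¹(·) a) ⊗ id)(Δ b)`. -/
theorem conv_hat_hat (a b : A) :
    conv G.Δ (G.hat a) (G.hat b) = G.hat (lslice (G.hat a ∘ₗ G.Sinv) (G.Δ b)) := by
  ext c
  have h : rslice G.φ (G.Δ c * (1 ⊗ₜ[ℂ] b)) = G.Sinv (rslice G.φ ((1 ⊗ₜ[ℂ] c) * G.Δ b)) := by
    rw [G.φ_strong, G.S_leftinv]
  have h₂ := G.apply_rslice_one_tmul_mul (G.hat a ∘ₗ G.Sinv) c (G.Δ b)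
  calc conv G.Δ (G.hat a) (G.hat b) c
      = G.φ (rslice G.φ (G.Δ c * (1 ⊗ₜ[ℂ] b)) * a) := G.pair_hat_hat a b (G.Δ c)
    _ = _ := by rw [h]; exact h₂

theorem ε_of_hat_eq_conv {a b e : A} (h : G.hat e = conv G.Δ (G.hat a) (G.hat b)) :
    G.ε e = G.φ (G.Sinv b * a) := by
  rw [conv_hat_hat] at h
  rw [G.hat_injective h, ε_lslice, G.counit_right]
  rfl

theorem S_δinv : G.S G.δinv = G.δ := by
  have h : G.δinv * G.S G.δinv = 1 := by
    rw [← G.S_δ, ← G.S_antimul, G.S_δ, G.δinv_mul_δ, G.S_one]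
  rw [← one_mul (G.S G.δinv), ← G.δ_mul_δinv, mul_assoc, h, mul_one]

theorem φ_δ_mul_S (z : A) : G.φ (G.δ * G.S z) = G.φ z := by
  rw [← G.S_δinv, ← G.S_antimul, G.φ_S, mul_assoc, G.δinv_mul_δ, mul_one]

theorem Sinv_S_S_mul_δinv (a : A) : G.Sinv (G.S (G.S a) * G.δinv) = G.δ * G.S a := by
  rw [← G.S_δ, ← G.S_antimul, G.S_leftinv]

end AQG

/-- Lemma 2.2(1): `ψ̂(â · b̂) = ψ̂(b̂ · (S²(a)δ⁻¹)^)`, i.e. `ρ̂(â) = (S²(a)δ⁻¹)^`. -/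
theorem stmt4 {A : Type*} [Ring A] [Algebra ℂ A] [StarRing A] [StarModule ℂ A]
    (G : AQG A) :
    ∀ a b e f : A,
      G.hat e = conv G.Δ (G.hat a) (G.hat b) →
      G.hat f = conv G.Δ (G.hat b) (G.hat (G.S (G.S a) * G.δinv)) →
      G.ε e = G.ε f := by
  intro a b e f he hf
  rw [G.ε_of_hat_eq_conv he, G.ε_of_hat_eq_conv hf, G.Sinv_S_S_mul_δinv,
    ← G.φ_δ_mul_S (G.Sinv b * a), G.S_antimul, G.S_rightinv, mul_assoc]
end
end

section
/- Let a ∈ A and suppose c ∈ A satisfies ĉ · (S(a*))^ = (S(a*))^ (convolution of linear functionals on A). Then (id ⊗ φ)((1 ⊗ c*) Δ(a)) = a; equivalently, (φ ⊗ φ)((b* ⊗ c*) Δ(a)) = φ(b* a) for all b ∈ A. (Lemma 2.4.) -/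
open scoped TensorProduct ComplexOrder

noncomputable section

namespace HopfAlgebra

open Coalgebra LinearMap WithConv

/-- The antipode of a Hopf algebra reverses the comultiplication. -/
theorem comul_antipode {R A : Type*} [CommSemiring R] [Semiring A] [HopfAlgebra R A] (a : A) :
    comul (R := R) (antipode R a) =
      TensorProduct.map (antipode R) (antipode R) (TensorProduct.comm R A A (comul a)) := by
  let i₁ : A →ₐ[R] A ⊗[R] A := Algebra.TensorProduct.includeLeft
  let i₂ : A →ₐ[R] A ⊗[R] A := Algebra.TensorProduct.includeRight
  have antipode_comp_mul (h : A →ₐ[R] A ⊗[R] A) :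
      toConv (h.toLinearMap ∘ₗ antipode R) * toConv h.toLinearMap = 1 := by
    have := algHom_comp_convMul_distrib h (toConv (antipode R (A := A))) (toConv LinearMap.id)
    rw [antipode_mul_id] at this
    refine (congrArg toConv this.symm).trans ?_
    ext x
    simp [LinearMap.convOne_def]
  have comul_eq : toConv (comul (R := R) (A := A)) =
      toConv i₁.toLinearMap * toConv i₂.toLinearMap := by
    ext x
    rw [(ℛ R x).convMul_apply]
    simp [i₁, i₂, (ℛ R x).eq]
  have left_inv : (toConv (i₂.toLinearMap ∘ₗ antipode R) * toConv (i₁.toLinearMap ∘ₗ antipode R)) *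
      toConv (comul (R := R) (A := A)) = 1 := by
    rw [comul_eq, mul_assoc, ← mul_assoc (toConv (i₁.toLinearMap ∘ₗ antipode R)),
      antipode_comp_mul, one_mul, antipode_comp_mul]
  have key := congrArg (fun f => f a) (left_inv_eq_right_inv left_inv comul_right_inv)
  simp only [(ℛ R a).convMul_apply] at key
  refine Eq.trans key.symm ?_
  conv_rhs => rw [← (ℛ R a).eq]
  simp [i₁, i₂]

end HopfAlgebra

namespace AQG

variable {A : Type*} [Ring A] [Algebra ℂ A] [StarRing A] [StarModule ℂ A] (G : AQG A)

/-- The Hopf algebra underlying an algebraic quantum group. -/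
abbrev hopfAlgebra : HopfAlgebra ℂ A where
  comul := G.Δ.toLinearMap
  counit := G.ε.toLinearMap
  coassoc := LinearMap.ext G.coassoc
  rTensor_counit_comp_comul := LinearMap.ext fun a =>
    (TensorProduct.lid ℂ A).injective <| by simpa using! G.counit_left a
  lTensor_counit_comp_comul := LinearMap.ext fun a =>
    (TensorProduct.rid ℂ A).injective <| by simpa using! G.counit_right a
  counit_one := map_one G.ε
  mul_compr₂_counit := by ext; simp
  comul_one := map_one G.Δ
  mul_compr₂_comul := by ext; simp
  antipode := G.S
  mul_antipode_rTensor_comul := LinearMap.ext fun a =>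
    (G.antipode_left a).trans (Algebra.algebraMap_eq_smul_one _).symm
  mul_antipode_lTensor_comul := LinearMap.ext fun a =>
    (G.antipode_right a).trans (Algebra.algebraMap_eq_smul_one _).symm

theorem Δ_S (a : A) :
    G.Δ (G.S a) = TensorProduct.map G.S G.S (TensorProduct.comm ℂ A A (G.Δ a)) :=
  letI := G.hopfAlgebra
  HopfAlgebra.comul_antipode (R := ℂ) a

/-- A positive functional on a unital `*`-algebra is hermitian. -/
theorem φ_star (a : A) : G.φ (star a) = starRingEnd ℂ (G.φ a) := by
  have real (x : A) : (G.φ (star x * x)).im = 0 :=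
    (Complex.nonneg_iff.mp (G.φ_pos x)).2.symm
  have h₀ := real 1
  have h₁ := real a
  have h₂ := real (1 + a)
  have h₃ := real (1 + Complex.I • a)
  simp only [star_add, star_one, star_smul, mul_add, add_mul, one_mul, mul_one, map_add,
    smul_mul_assoc, mul_smul_comm, map_smul, smul_eq_mul, Complex.add_im, Complex.mul_im,
    Complex.mul_re, Complex.I_re, Complex.I_im, RCLike.star_def, Complex.conj_I, Complex.neg_re,
    Complex.neg_im] at h₀ h₁ h₂ h₃
  apply Complex.ext
  · rw [Complex.conj_re]; linarith
  · rw [Complex.conj_im]; linarith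

theorem eq_of_forall_φ_mul_eq {u v : A} (h : ∀ x, G.φ (x * u) = G.φ (x * v)) : u = v :=
  sub_eq_zero.mp <| G.φ_faithful _ <| by rw [mul_sub, map_sub, h, sub_self]

/-- Convolution with the functional of `S y`, computed by strong left invariance. -/
theorem conv_hat_S_apply (c x y : A) :
    conv G.Δ (G.hat c) (G.hat (G.S y)) x = G.φ (x * G.S (rslice (G.hat c) (G.Δ y))) := by
  have slice_right (t : A ⊗[ℂ] A) : pair (G.hat c) (G.hat (G.S y)) t =
      G.hat c (rslice G.φ (t * (1 ⊗ₜ[ℂ] G.S y))) := by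
    induction t with
    | zero => simp
    | add s t hs ht => simp only [add_mul, map_add, hs, ht]
    | tmul p q => simp [pair, rslice, hat, mul_comm]
  have slice_swap (t : A ⊗[ℂ] A) :
      G.hat c (G.Sinv (rslice G.φ ((1 ⊗ₜ[ℂ] x) *
        TensorProduct.map G.S G.S (TensorProduct.comm ℂ A A t)))) =
      G.φ (x * G.S (rslice (G.hat c) t)) := by
    induction t with
    | zero => simp
    | add s t hs ht => simp only [mul_add, map_add, hs, ht]
    | tmul p q => simp [rslice, hat, G.S_leftinv q, mul_comm]
  rw [← slice_swap, ← Δ_S, G.φ_strong, G.S_leftinv]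
  exact slice_right _

/-- Slicing intertwines the involution of `A`. -/
theorem rslice_star (c y : A) :
    rslice G.φ ((1 ⊗ₜ[ℂ] star c) * G.Δ (star y)) = star (rslice (G.hat c) (G.Δ y)) := by
  refine (Module.forall_dual_apply_eq_zero_iff ℂ _).mp (fun f => ?_) |> sub_eq_zero.mp
  rw [map_sub, sub_eq_zero]
  have hat_eq : conjdual (G.φ ∘ₗ LinearMap.mulLeft ℂ (star c)) = G.hat c := by
    ext x
    simp [conjdual, hat, ← G.φ_star]
  have slice_left (t : A ⊗[ℂ] A) : f (rslice G.φ ((1 ⊗ₜ[ℂ] star c) * t)) =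
      pair f (G.φ ∘ₗ LinearMap.mulLeft ℂ (star c)) t := by
    induction t with
    | zero => simp
    | add s t hs ht => simp only [mul_add, map_add, hs, ht]
    | tmul p q => simp [pair, rslice, mul_comm]
  have slice_conj (t : A ⊗[ℂ] A) : pair (conjdual f) (G.hat c) t =
      conjdual f (rslice (G.hat c) t) := by
    induction t with
    | zero => simp
    | add s t hs ht => simp only [map_add, hs, ht]
    | tmul p q => simp [pair, rslice, mul_comm]
  rw [slice_left, G.Δ_star, hat_eq, slice_conj]
  simp [conjdual]

end AQG

/-- Lemma 2.4: if `ĉ · (S(a*))^ = (S(a*))^` then `(id ⊗ φ)((1 ⊗ c*)Δ(a)) = a`. -/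
theorem stmt8 {A : Type*} [Ring A] [Algebra ℂ A] [StarRing A] [StarModule ℂ A]
    (G : AQG A) :
    ∀ a c : A,
      conv G.Δ (G.hat c) (G.hat (G.S (star a))) = G.hat (G.S (star a)) →
      rslice G.φ (((1 : A) ⊗ₜ[ℂ] star c) * G.Δ a) = a := by
  intro a c h
  have slice_eq : rslice (G.hat c) (G.Δ (star a)) = star a :=
    G.S_leftinv.injective <| G.eq_of_forall_φ_mul_eq fun x => by
      rw [← G.conv_hat_S_apply, h]
      rfl
  simpa [slice_eq] using G.rslice_star c (star a)
end
end

section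
/- Let a, b ∈ A and a₁, b₁, …, aₙ, bₙ ∈ A satisfy Δ(b)(a ⊗ 1) = Σₖ aₖ ⊗ bₖ in A ⊗ A. Then for every ω ∈ Â (i.e. ω = d̂ for some d ∈ A), the convolution product ((aω) ∘ S) · b̂ equals Σₖ ω(aₖ) b̂ₖ, where aω denotes the functional (aω)(x) = ω(xa); explicitly, for all c ∈ A: (((aω) ∘ S) ⊗ b̂)(Δ(c)) = Σₖ ω(aₖ) φ(c bₖ). (Lemma 2.5.) -/
open scoped TensorProduct ComplexOrder

noncomputable section

/-- Slicing `t (1 ⊗ b)` by `φ` and then applying `f` is pairing `t` with `f` and `φ(· b)`. -/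
theorem map_rslice_mul_one_tmul {A : Type*} [Ring A] [Algebra ℂ A] (f φ : A →ₗ[ℂ] ℂ)
    (b : A) (t : A ⊗[ℂ] A) :
    f (rslice φ (t * (1 ⊗ₜ[ℂ] b))) = pair f (φ ∘ₗ LinearMap.mulRight ℂ b) t := by
  induction t using TensorProduct.induction_on with
  | zero => simp
  | tmul x y => simp [rslice, pair, mul_comm]
  | add x y hx hy => simp only [add_mul, map_add, hx, hy]

/-- Slicing `(1 ⊗ c) t` by `φ` and then applying `f(· a)` is pairing `t (a ⊗ 1)` with `f` and
`φ(c ·)`. -/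
theorem map_rslice_one_tmul_mul {A : Type*} [Ring A] [Algebra ℂ A] (f φ : A →ₗ[ℂ] ℂ)
    (a c : A) (t : A ⊗[ℂ] A) :
    f (rslice φ ((1 ⊗ₜ[ℂ] c) * t) * a) =
      pair f (φ ∘ₗ LinearMap.mulLeft ℂ c) (t * (a ⊗ₜ[ℂ] 1)) := by
  induction t using TensorProduct.induction_on with
  | zero => simp
  | tmul x y => simp [rslice, pair, mul_comm]
  | add x y hx hy => simp only [add_mul, mul_add, map_add, hx, hy]

/-- Lemma 2.5: if `Δ(b)(a ⊗ 1) = Σₖ aₖ ⊗ bₖ` then for every `ω ∈ Â`,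
`((aω) ∘ S) · b̂ = Σₖ ω(aₖ) b̂ₖ`. -/
theorem stmt9 {A : Type*} [Ring A] [Algebra ℂ A] [StarRing A] [StarModule ℂ A]
    (G : AQG A) (a b : A) (n : ℕ) (aa bb : Fin n → A)
    (h : G.Δ b * (a ⊗ₜ[ℂ] (1 : A)) = ∑ k, aa k ⊗ₜ[ℂ] bb k) :
    ∀ d c : A,
      conv G.Δ (G.hat d ∘ₗ LinearMap.mulRight ℂ a ∘ₗ G.S) (G.hat b) c =
        ∑ k, G.hat d (aa k) * G.φ (c * bb k) := by
  intro d c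
  calc
    _ = G.hat d (G.S (rslice G.φ (G.Δ c * (1 ⊗ₜ[ℂ] b))) * a) :=
      (map_rslice_mul_one_tmul (G.hat d ∘ₗ LinearMap.mulRight ℂ a ∘ₗ G.S) G.φ b (G.Δ c)).symm
    _ = pair (G.hat d) (G.φ ∘ₗ LinearMap.mulLeft ℂ c) (G.Δ b * (a ⊗ₜ[ℂ] 1)) := by
      rw [← G.φ_strong, map_rslice_one_tmul_mul]
    _ = _ := by
      rw [h]
      simp [pair]
end
end

section
/- Let a, b, c ∈ A, and let finite families in A satisfy Δ(b)(a ⊗ 1) = Σₖ aₖ ⊗ bₖ, b ⊗ c = Σᵢ Δ(pᵢ)(qᵢ ⊗ 1), and, for each i, Δ(pᵢ)(a ⊗ 1) = Σⱼ xᵢⱼ ⊗ yᵢⱼ. Then in A' ⊗ A (A' the linear dual of A): Σᵢ Σⱼ φ(qᵢ) ŷᵢⱼ ⊗ xᵢⱼ = Σₖ (b̂ₖ · ĉ) ⊗ aₖ, where b̂ₖ · ĉ denotes the convolution product. (Lemma 2.6.) -/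
open scoped TensorProduct ComplexOrder

noncomputable section

section

variable {A : Type*} [Ring A] [Algebra ℂ A]

lemma pair_tmul (ω η : A →ₗ[ℂ] ℂ) (u v : A) : pair ω η (u ⊗ₜ[ℂ] v) = ω u * η v := rfl

lemma rslice_tmul {M : Type*} [AddCommGroup M] [Module ℂ M] (ω : A →ₗ[ℂ] ℂ) (u : M) (v : A) :
    rslice ω (u ⊗ₜ[ℂ] v) = ω v • u := rfl

/-- `(ω ⊗ η)(w (q ⊗ 1)) = ω((id ⊗ η)(w) q)`. -/
lemma pair_mul_tmul_one (ω η : A →ₗ[ℂ] ℂ) (w : A ⊗[ℂ] A) (q : A) :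
    pair ω η (w * (q ⊗ₜ[ℂ] (1 : A))) = ω (rslice η w * q) := by
  induction w with
  | zero => simp
  | tmul u v => simp [pair_tmul, rslice_tmul, mul_comm]
  | add w₁ w₂ h₁ h₂ => simp only [add_mul, map_add, h₁, h₂]

lemma tensorAssoc_mul (w w' : (A ⊗[ℂ] A) ⊗[ℂ] A) :
    TensorProduct.assoc ℂ A A A (w * w') =
      TensorProduct.assoc ℂ A A A w * TensorProduct.assoc ℂ A A A w' :=
  map_mul (Algebra.TensorProduct.assoc ℂ ℂ ℂ A A A) w w'

end

namespace AQG

variable {A : Type*} [Ring A] [Algebra ℂ A] [StarRing A] [StarModule ℂ A] (G : AQG A)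

lemma hat_apply (a c : A) : G.hat a c = G.φ (c * a) := rfl

/-- The map `a ↦ â`, as a linear map. -/
def hatₗ : A →ₗ[ℂ] A →ₗ[ℂ] ℂ where
  toFun := G.hat
  map_add' u v := by ext; simp [hat_apply, mul_add]
  map_smul' t u := by ext; simp [hat_apply]

lemma pair_hat (u v : A) (w : A ⊗[ℂ] A) :
    pair (G.hat u) (G.hat v) w = pair G.φ G.φ (w * (u ⊗ₜ[ℂ] v)) := by
  induction w with
  | zero => simp
  | tmul s t => simp [pair_tmul, hat_apply]
  | add w₁ w₂ h₁ h₂ => simp only [add_mul, map_add, h₁, h₂]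

/-- The linear map `A ⊗ A → A'` sending `w` to `z ↦ (φ ⊗ φ)(Δ(z) w)`. -/
def convHat : A ⊗[ℂ] A →ₗ[ℂ] A →ₗ[ℂ] ℂ :=
  ((LinearMap.mul ℂ (A ⊗[ℂ] A)).flip.compr₂ (pair G.φ G.φ)).compl₂ G.Δ.toLinearMap

lemma convHat_apply (w : A ⊗[ℂ] A) (z : A) :
    G.convHat w z = pair G.φ G.φ (G.Δ z * w) := rfl

lemma convHat_tmul (u v : A) : G.convHat (u ⊗ₜ[ℂ] v) = conv G.Δ (G.hat u) (G.hat v) :=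
  LinearMap.ext fun z => (G.pair_hat u v (G.Δ z)).symm

/-- Left invariance of `φ`, transported to the convolution product. -/
lemma convHat_comul_mul (p q : A) :
    G.convHat (G.Δ p * (q ⊗ₜ[ℂ] (1 : A))) = G.φ q • G.hat p := by
  ext z
  rw [convHat_apply, ← mul_assoc, ← map_mul, pair_mul_tmul_one, φ_left_inv]
  simp [hat_apply, mul_comm]

/-- The linear map `u ⊗ w ↦ convHat w ⊗ u a`. -/
def convHatMul (a : A) : A ⊗[ℂ] (A ⊗[ℂ] A) →ₗ[ℂ] (A →ₗ[ℂ] ℂ) ⊗[ℂ] A :=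
  (TensorProduct.comm ℂ A (A →ₗ[ℂ] ℂ)).toLinearMap ∘ₗ
    TensorProduct.map (LinearMap.mulRight ℂ a) G.convHat

lemma convHatMul_tmul (a u : A) (w : A ⊗[ℂ] A) :
    G.convHatMul a (u ⊗ₜ[ℂ] w) = G.convHat w ⊗ₜ[ℂ] (u * a) := rfl

/-- The linear map `u ⊗ v ↦ v̂ ⊗ u`. -/
def hatSwap : A ⊗[ℂ] A →ₗ[ℂ] (A →ₗ[ℂ] ℂ) ⊗[ℂ] A :=
  (TensorProduct.comm ℂ A (A →ₗ[ℂ] ℂ)).toLinearMap ∘ₗ TensorProduct.map LinearMap.id G.hatₗ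

lemma hatSwap_tmul (u v : A) : G.hatSwap (u ⊗ₜ[ℂ] v) = G.hat v ⊗ₜ[ℂ] u := rfl

lemma map_comul_id_mul (w : A ⊗[ℂ] A) (q : A) :
    TensorProduct.map G.Δ.toLinearMap LinearMap.id (w * (q ⊗ₜ[ℂ] (1 : A))) =
      TensorProduct.map G.Δ.toLinearMap LinearMap.id w * (G.Δ q ⊗ₜ[ℂ] (1 : A)) := by
  induction w with
  | zero => simp
  | tmul u v => simp
  | add w₁ w₂ h₁ h₂ => simp only [add_mul, map_add, h₁, h₂]

lemma convHatMul_map_comul_mul (a : A) (w t : A ⊗[ℂ] A) :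
    G.convHatMul a (TensorProduct.map LinearMap.id G.Δ.toLinearMap w *
        TensorProduct.assoc ℂ A A A (t ⊗ₜ[ℂ] (1 : A))) =
      G.hatSwap (w * ((rslice G.φ t * a) ⊗ₜ[ℂ] (1 : A))) := by
  induction t with
  | zero => simp
  | add t₁ t₂ h₁ h₂ =>
    simp only [TensorProduct.add_tmul, map_add, mul_add, add_mul, h₁, h₂]
  | tmul s t =>
    induction w with
    | zero => simp
    | add w₁ w₂ h₁ h₂ => simp only [add_mul, map_add, h₁, h₂]
    | tmul u v =>
      simp [convHatMul_tmul, hatSwap_tmul, rslice_tmul, convHat_comul_mul,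
        TensorProduct.smul_tmul, mul_assoc]

/-- The identity behind the main theorem, for a single pair `p`, `q`. -/
lemma convHatMul_comul (a p q : A) :
    G.convHatMul a (TensorProduct.assoc ℂ A A A
        (TensorProduct.map G.Δ.toLinearMap LinearMap.id (G.Δ p * (q ⊗ₜ[ℂ] (1 : A))))) =
      G.φ q • G.hatSwap (G.Δ p * (a ⊗ₜ[ℂ] (1 : A))) := by
  rw [map_comul_id_mul, tensorAssoc_mul, coassoc, convHatMul_map_comul_mul, φ_left_inv, smul_one_mul,
    ← TensorProduct.smul_tmul', mul_smul_comm, map_smul]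

lemma convHatMul_assoc_tmul (a c : A) (w : A ⊗[ℂ] A) :
    G.convHatMul a (TensorProduct.assoc ℂ A A A (w ⊗ₜ[ℂ] c)) =
      G.convHatMul 1 (TensorProduct.assoc ℂ A A A ((w * (a ⊗ₜ[ℂ] (1 : A))) ⊗ₜ[ℂ] c)) := by
  induction w with
  | zero => simp
  | tmul u v => simp [convHatMul_tmul]
  | add w₁ w₂ h₁ h₂ => simp only [add_mul, TensorProduct.add_tmul, map_add, h₁, h₂]

end AQG

/-- Lemma 2.6: with `Δ(b)(a ⊗ 1) = Σₖ aₖ ⊗ bₖ`, `b ⊗ c = Σᵢ Δ(pᵢ)(qᵢ ⊗ 1)` and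
`Δ(pᵢ)(a ⊗ 1) = Σⱼ xᵢⱼ ⊗ yᵢⱼ`, one has
`Σᵢⱼ φ(qᵢ) ŷᵢⱼ ⊗ xᵢⱼ = Σₖ (b̂ₖ ĉ) ⊗ aₖ` in `A' ⊗ A`. -/
theorem stmt10 {A : Type*} [Ring A] [Algebra ℂ A] [StarRing A] [StarModule ℂ A]
    (G : AQG A) (a b c : A) (n r : ℕ) (aa bb : Fin n → A) (p q : Fin r → A)
    (s : Fin r → ℕ) (x y : (i : Fin r) → Fin (s i) → A)
    (h1 : G.Δ b * (a ⊗ₜ[ℂ] (1 : A)) = ∑ k, aa k ⊗ₜ[ℂ] bb k)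
    (h2 : b ⊗ₜ[ℂ] c = ∑ i, G.Δ (p i) * (q i ⊗ₜ[ℂ] (1 : A)))
    (h3 : ∀ i, G.Δ (p i) * (a ⊗ₜ[ℂ] (1 : A)) = ∑ j, x i j ⊗ₜ[ℂ] y i j) :
    (∑ i, ∑ j, G.φ (q i) • (G.hat (y i j) ⊗ₜ[ℂ] x i j)) =
      ∑ k, conv G.Δ (G.hat (bb k)) (G.hat c) ⊗ₜ[ℂ] aa k := by
  have h := congrArg (fun w => G.convHatMul a (TensorProduct.assoc ℂ A A A
    (TensorProduct.map G.Δ.toLinearMap LinearMap.id w))) h2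
  simp only [map_sum, G.convHatMul_comul, h3, TensorProduct.map_tmul, LinearMap.id_apply,
    AlgHom.toLinearMap_apply, G.convHatMul_assoc_tmul a, h1, TensorProduct.sum_tmul,
    TensorProduct.assoc_tmul, AQG.convHatMul_tmul, AQG.hatSwap_tmul, AQG.convHat_tmul, mul_one,
    Finset.smul_sum] at h
  exact h.symm
end
end
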